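/- Let (X, ρ, 𝒞) be a semi-Cartan graph with GRS Δ, Weyl groupoid 𝒲, and nil-Hecke algebra 𝒩 over a commutative ring 𝕂, and let Λ : 𝒩 → End_𝕂(𝕂𝒲) be the algebra homomorphism with Λ(e^x) = E^x, Λ(n_i^x) = L_i^x. Then the 𝕂-linear map Φ : 𝒩 → 𝕂𝒲 defined by Φ(n) := Λ(n)(1), where 1 := Σ_{x∈X} id_x ∈ 𝕂𝒲, is an isomorphism of 𝕂-modules; moreover Φ(T_w) = w for every morphism w of 𝒲. -/

import Mathlib

open CategoryTheory

noncomputable section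

namespace WeylGroupoid

variable {θ : ℕ} {X : Type} [Fintype X] [DecidableEq X]

/-- A *semi-Cartan graph*: a basic datum `(X, ρ)` together with a compatible bundle of
generalized Cartan matrices. -/
structure SCG (θ : ℕ) (X : Type) [Fintype X] [DecidableEq X] : Type where
  nonempty : Nonempty X
  /-- the involutions `ρ_i` of the basic datum -/
  ρ : Fin θ → X → X
  invol : ∀ i x, ρ i (ρ i x) = x
  /-- the bundle of generalized Cartan matrices `C^x` -/
  C : X → Fin θ → Fin θ → ℤ
  diag : ∀ x i, C x i i = 2
  offdiag : ∀ x i j, i ≠ j → C x i j ≤ 0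
  zero_iff : ∀ x i j, i ≠ j → (C x i j = 0 ↔ C x j i = 0)
  compat : ∀ x i j, C (ρ i x) i j = C x i j

/-- the simple root `α_i ∈ ℤ^θ` -/
def al (θ : ℕ) (i : Fin θ) : Fin θ → ℤ := Pi.single i 1

/-- the reflection `s_i^x` of `ℤ^θ`, `s_i^x (α_j) = α_j - c^x_{ij} α_i` -/
def srefl (G : SCG θ X) (x : X) (i : Fin θ) (v : Fin θ → ℤ) : Fin θ → ℤ :=
  fun k => v k - (if k = i then ∑ j, G.C x i j * v j else 0)

/-- the cone `ℕ₀ α_i + ℕ₀ α_j` -/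
def pairCone (θ : ℕ) (i j : Fin θ) : Set (Fin θ → ℤ) :=
  {v | ∃ a b : ℕ, v = (a : ℤ) • al θ i + (b : ℤ) • al θ j}

/-- A *generalized root system* on a semi-Cartan graph. -/
structure GRS (G : SCG θ X) : Type where
  /-- the root sets `Δ^x` -/
  Δ : X → Set (Fin θ → ℤ)
  pos_neg : ∀ x, Δ x = (Δ x ∩ {v | ∀ k, 0 ≤ v k}) ∪ (-(Δ x ∩ {v | ∀ k, 0 ≤ v k}))
  simple : ∀ x i, Δ x ∩ {v | ∃ c : ℤ, v = c • al θ i} = {al θ i, -al θ i}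
  reflect : ∀ x i, (srefl G x i) '' Δ x = Δ (G.ρ i x)
  pairFinite : ∀ x i j, (Δ x ∩ pairCone θ i j).Finite
  loop : ∀ x i j, (fun y => G.ρ i (G.ρ j y))^[(Δ x ∩ pairCone θ i j).ncard] x = x

variable (G : SCG θ X)

/-- The entries `m^x_{ij} = |Δ^x ∩ (ℕ₀α_i + ℕ₀α_j)|`. -/
def mnum (R : GRS G) (x : X) (i j : Fin θ) : ℕ := (R.Δ x ∩ pairCone θ i j).ncard

/-- the set of positive roots `Δ^x_+` -/
def posRoots (R : GRS G) (x : X) : Set (Fin θ → ℤ) := R.Δ x ∩ {v | ∀ k, 0 ≤ v k}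

/-- The objects of the Weyl groupoid (a type synonym for `X` carrying a quiver
structure depending on `G`). -/
def Obj (G : SCG θ X) : Type := X

instance : Quiver (Obj G) := ⟨fun a b => {i : Fin θ // G.ρ i (show X from b) = (show X from a)}⟩

/-- objects of the path category -/
def pob (x : X) : Paths (Obj G) := (x : X)

/-- the generating arrow `σ_i^x : ρ_i(x) → x` -/
def genArrow (x : X) (i : Fin θ) : pob G (G.ρ i x) ⟶ pob G x :=
  Quiver.Path.nil.cons (⟨i, rfl⟩ : (show Obj G from G.ρ i x) ⟶ (show Obj G from x))

/-- the source of the word `σ_{i_1}^x σ_{i_2} ⋯ σ_{i_m}` (with target `x`) -/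
def wsrc (G : SCG θ X) : List (Fin θ) → X → X
  | [], x => x
  | i :: l, x => wsrc G l (G.ρ i x)

/-- the path `σ_{i_1}^x σ_{i_2} ⋯ σ_{i_m} : wsrc(w,x) → x` in the free category -/
def pathOf (G : SCG θ X) : (w : List (Fin θ)) → (x : X) → (pob G (wsrc G w x) ⟶ pob G x)
  | [], _ => 𝟙 _
  | i :: l, x => (pathOf G l (G.ρ i x)) ≫ genArrow G x i


/-- transport a path along an equality of sources -/
def castSrc {a b c : X} (h : a = b) (f : pob G a ⟶ pob G c) : pob G b ⟶ pob G c := by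
  subst h; exact f

/-- the alternating word `[i, j, i, j, …]` of length `n` -/
def altWord (i j : Fin θ) : ℕ → List (Fin θ)
  | 0 => []
  | n + 1 => i :: altWord j i n

/-- The defining relations `(σ_i^x σ_j)^{m^x_{ij}} = id_x` of the Weyl groupoid. -/
inductive wrel (R : GRS G) : HomRel (Paths (Obj G))
  | rel (x : X) (i j : Fin θ)
      (h : wsrc G (altWord i j (2 * mnum G R x i j)) x = x) :
      wrel R (castSrc G h (pathOf G (altWord i j (2 * mnum G R x i j)) x))
        (𝟙 (pob G x))

variable (R : GRS G)

/-- The Weyl groupoid, as the quotient of the free category on the quiver of the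
`σ_i^x` by the relations `(σ_i^x σ_j)^{m^x_{ij}} = id_x` (every generator is invertible
in this quotient, so it is indeed a groupoid). -/
def W := CategoryTheory.Quotient (wrel G R)

instance : Category (W G R) := inferInstanceAs (Category (CategoryTheory.Quotient (wrel G R)))

/-- objects of the Weyl groupoid -/
def objW (x : X) : W G R := ⟨pob G x⟩

/-- hom-sets `𝒲(y, x)` of the Weyl groupoid -/
def homW (y x : X) := objW G R y ⟶ objW G R x

instance {y x : X} : CoeSort (homW G R y x) (objW G R y ⟶ objW G R x) := ⟨id⟩

/-- the morphism of the Weyl groupoid defined by the word `σ_{i_1}^x ⋯ σ_{i_m}` -/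
def morW (w : List (Fin θ)) (x : X) : homW G R (wsrc G w x) x :=
  (Quotient.functor (wrel G R)).map (pathOf G w x)

/-- the generator `σ_i^x : ρ_i(x) → x` in the Weyl groupoid -/
def genW (x : X) (i : Fin θ) : homW G R (G.ρ i x) x :=
  (Quotient.functor (wrel G R)).map (genArrow G x i)

/-- transport a morphism of the Weyl groupoid along an equality of sources -/
def castW {a b c : X} (h : a = b) (f : homW G R a c) : homW G R b c := by
  subst h; exact f

/-- transport a morphism of the Weyl groupoid along an equality of targets -/
def castTgt {a c c' : X} (h : c = c') (f : homW G R a c) : homW G R a c' := by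
  subst h; exact f

/-- the length `ℓ(f)` of a morphism of the Weyl groupoid -/
def len {y x : X} (f : homW G R y x) : ℕ :=
  sInf {n | ∃ w : List (Fin θ), w.length = n ∧
    ∃ h : wsrc G w x = y, castW G R h (morW G R w x) = f}

/-- `w` is a reduced expression of the morphism `f ∈ 𝒲(y,x)` -/
def IsRedEx (w : List (Fin θ)) {y x : X} (f : homW G R y x) : Prop :=
  ∃ h : wsrc G w x = y, castW G R h (morW G R w x) = f ∧ w.length = len G R f


section NilHecke

variable (𝕂 : Type) [CommRing 𝕂]

/-- the generator `e^x` of the free algebra -/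
def eF (x : X) : FreeAlgebra 𝕂 (X ⊕ X × Fin θ) := FreeAlgebra.ι 𝕂 (Sum.inl x)

/-- the generator `n_i^x` of the free algebra -/
def nF (x : X) (i : Fin θ) : FreeAlgebra 𝕂 (X ⊕ X × Fin θ) := FreeAlgebra.ι 𝕂 (Sum.inr (x, i))

/-- the word `n_{i_1}^x n_{i_2} ⋯ n_{i_m}` in the free algebra
(superscripts determined by composability) -/
def nWF (G : SCG θ X) (𝕂 : Type) [CommRing 𝕂] :
    List (Fin θ) → X → FreeAlgebra 𝕂 (X ⊕ X × Fin θ)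
  | [], _ => 1
  | i :: l, x => nF 𝕂 x i * nWF G 𝕂 l (G.ρ i x)

/-- The defining relations of the nil-Hecke algebra of `(X, ρ, 𝒞)`. -/
inductive nrel (R : GRS G) (𝕂 : Type) [CommRing 𝕂] :
    FreeAlgebra 𝕂 (X ⊕ X × Fin θ) → FreeAlgebra 𝕂 (X ⊕ X × Fin θ) → Prop
  | orth (x y : X) (h : x ≠ y) : nrel R 𝕂 (eF 𝕂 x * eF 𝕂 y) 0
  | idem (x : X) : nrel R 𝕂 (eF 𝕂 x * eF 𝕂 x) (eF 𝕂 x)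
  | total : nrel R 𝕂 (∑ x : X, eF 𝕂 x) 1
  | unit_right (x : X) (i : Fin θ) : nrel R 𝕂 (nF 𝕂 x i * eF 𝕂 (G.ρ i x)) (nF 𝕂 x i)
  | unit_left (x : X) (i : Fin θ) : nrel R 𝕂 (eF 𝕂 x * nF 𝕂 x i) (nF 𝕂 x i)
  | nil (x : X) (i : Fin θ) : nrel R 𝕂 (nF 𝕂 (G.ρ i x) i * nF 𝕂 x i) 0
  | braid (x : X) (i j : Fin θ) (hij : i ≠ j) :
      nrel R 𝕂 (nWF G 𝕂 (altWord i j (mnum G R x i j)) x)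
        (nWF G 𝕂 (altWord j i (mnum G R x i j)) x)

/-- The nil-Hecke algebra `𝒩(X, ρ, 𝒞)` of a Weyl groupoid over `𝕂`. -/
def NH := RingQuot (nrel G R 𝕂)

instance : Ring (NH G R 𝕂) := inferInstanceAs (Ring (RingQuot (nrel G R 𝕂)))
instance : Algebra 𝕂 (NH G R 𝕂) := inferInstanceAs (Algebra 𝕂 (RingQuot (nrel G R 𝕂)))

/-- the generator `e^x` of the nil-Hecke algebra -/
def eN (x : X) : NH G R 𝕂 := RingQuot.mkAlgHom 𝕂 (nrel G R 𝕂) (eF 𝕂 x)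

/-- the generator `n_i^x` of the nil-Hecke algebra -/
def nN (x : X) (i : Fin θ) : NH G R 𝕂 := RingQuot.mkAlgHom 𝕂 (nrel G R 𝕂) (nF 𝕂 x i)

/-- the word `n_{i_1}^x n_{i_2} ⋯ n_{i_m}` in the nil-Hecke algebra -/
def nW (w : List (Fin θ)) (x : X) : NH G R 𝕂 := RingQuot.mkAlgHom 𝕂 (nrel G R 𝕂) (nWF G 𝕂 w x)

/-- the set of morphisms of the Weyl groupoid -/
def Mor := Σ (y : X) (x : X), homW G R y x

/-- the free `𝕂`-module `𝕂𝒲` on the set of morphisms of the Weyl groupoid -/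
abbrev KW := Mor G R →₀ 𝕂

/-- the endomorphism `E^x` of `𝕂𝒲` -/
def Emap (x : X) : KW G R 𝕂 →ₗ[𝕂] KW G R 𝕂 :=
  Finsupp.lift (KW G R 𝕂) 𝕂 (Mor G R)
    (fun m => if m.2.1 = x then Finsupp.single m 1 else 0)

/-- the value of the endomorphism `L_i^x` of `𝕂𝒲` on a basis morphism -/
def Lval (x : X) (i : Fin θ) (m : Mor G R) : KW G R 𝕂 :=
  if h : m.2.1 = G.ρ i x then
    (let f' : homW G R m.1 x := castTgt G R h m.2.2 ≫ genW G R x i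
     if len G R m.2.2 < len G R f' then Finsupp.single ⟨m.1, x, f'⟩ 1 else 0)
  else 0

/-- the endomorphism `L_i^x` of `𝕂𝒲` -/
def Lmap (x : X) (i : Fin θ) : KW G R 𝕂 →ₗ[𝕂] KW G R 𝕂 :=
  Finsupp.lift (KW G R 𝕂) 𝕂 (Mor G R) (Lval G R 𝕂 x i)

end NilHecke

end WeylGroupoid


namespace WeylGroupoid

section Words

variable {θ : ℕ} {X : Type} [Fintype X] [DecidableEq X] (G : SCG θ X) (R : GRS G)

/-- The morphism defined by a word, bundled with its source and target. -/
def wordMor (w : List (Fin θ)) (x : X) : Mor G R := ⟨wsrc G w x, x, morW G R w x⟩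

/-- The length of a bundled morphism. -/
def lenMor (m : Mor G R) : ℕ := len G R m.2.2

/-- Left multiplication of a morphism with target `ρ_i(x)` by `σ_i^x`. -/
def genMul (x : X) (i : Fin θ) (m : Mor G R) (h : m.2.1 = G.ρ i x) : Mor G R :=
  ⟨m.1, x, (castTgt G R h m.2.2 ≫ genW G R x i : objW G R m.1 ⟶ objW G R x)⟩

theorem wordMor_nil (x : X) : wordMor G R [] x = ⟨x, x, 𝟙 (objW G R x)⟩ := rfl

theorem genMul_wordMor (x : X) (i : Fin θ) (w : List (Fin θ)) :
    genMul G R x i (wordMor G R w (G.ρ i x)) rfl = wordMor G R (i :: w) x :=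
  congrArg (fun f : homW G R (wsrc G w (G.ρ i x)) x => (⟨_, x, f⟩ : Mor G R))
    ((CategoryTheory.Quotient.functor (wrel G R)).map_comp
      (pathOf G w (G.ρ i x)) (genArrow G x i)).symm

theorem wordMor_cons_congr {i : Fin θ} {x : X} {v w : List (Fin θ)}
    (h : wordMor G R v (G.ρ i x) = wordMor G R w (G.ρ i x)) :
    wordMor G R (i :: v) x = wordMor G R (i :: w) x := by
  have key : ∀ m m' : Mor G R, m = m' → ∀ hm hm',
      genMul G R x i m hm = genMul G R x i m' hm' := by
    rintro m _ rfl _ _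
    rfl
  rw [← genMul_wordMor, ← genMul_wordMor]
  exact key _ _ h rfl rfl

theorem exists_pathOf {a b : X} (p : pob G a ⟶ pob G b) :
    ∃ (w : List (Fin θ)) (h : wsrc G w b = a), castSrc G h (pathOf G w b) = p := by
  have cons_eq : ∀ {b c : Obj G} (e : b ⟶ c) (w : List (Fin θ)),
      ∃ (v : List (Fin θ)) (h : wsrc G v c = wsrc G w b),
        castSrc G h (pathOf G v c) = Quiver.Path.cons (pathOf G w b) e := by
    rintro b c ⟨i, hi⟩ w
    change G.ρ i c = b at hi
    revert hi
    refine Eq.rec ?_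
    exact ⟨i :: w, rfl, rfl⟩
  have key : ∀ {a b : Obj G} (p : Quiver.Path a b),
      ∃ (w : List (Fin θ)) (h : wsrc G w b = a), castSrc G h (pathOf G w b) = p := by
    intro a b p
    induction p with
    | nil => exact ⟨[], rfl, rfl⟩
    | cons p e ih =>
      obtain ⟨w, rfl, rfl⟩ := ih
      exact cons_eq e w
  exact key p

theorem exists_word {y x : X} (f : homW G R y x) :
    ∃ (w : List (Fin θ)) (h : wsrc G w x = y), castW G R h (morW G R w x) = f := by
  obtain ⟨p, rfl⟩ := (CategoryTheory.Quotient.functor (wrel G R)).map_surjective f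
  obtain ⟨w, rfl, rfl⟩ := exists_pathOf G p
  exact ⟨w, rfl, rfl⟩

theorem lenMor_wordMor_le (w : List (Fin θ)) (x : X) :
    lenMor G R (wordMor G R w x) ≤ w.length :=
  Nat.sInf_le ⟨w, rfl, rfl, rfl⟩

theorem exists_reduced_word (m : Mor G R) :
    ∃ w : List (Fin θ), wordMor G R w m.2.1 = m ∧ w.length = lenMor G R m := by
  obtain ⟨y, x, f⟩ := m
  have hne : {n | ∃ w : List (Fin θ), w.length = n ∧
      ∃ h : wsrc G w x = y, castW G R h (morW G R w x) = f}.Nonempty := by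
    obtain ⟨w, hw⟩ := exists_word G R f
    exact ⟨w.length, w, rfl, hw⟩
  obtain ⟨w, hlen, rfl, hw⟩ := Nat.sInf_mem hne
  subst hw
  exact ⟨w, rfl, hlen⟩

theorem length_castSrc {a b c : X} (h : a = b) (p : pob G a ⟶ pob G c) :
    Quiver.Path.length (castSrc G h p) = Quiver.Path.length p := by
  subst h
  rfl

theorem length_pathOf (w : List (Fin θ)) (x : X) :
    Quiver.Path.length (pathOf G w x) = w.length := by
  induction w generalizing x with
  | nil => rfl
  | cons i w ih => exact congrArg Nat.succ (ih (G.ρ i x))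

theorem length_altWord (i j : Fin θ) (n : ℕ) : (altWord i j n).length = n := by
  induction n generalizing i j with
  | zero => rfl
  | succ n ih => simp [altWord, ih]

/-- The functor recording the parity of the length of a path. -/
def pathParity : Paths (Obj G) ⥤ SingleObj (Multiplicative (ZMod 2)) where
  obj _ := SingleObj.star _
  map p := Multiplicative.ofAdd ((Quiver.Path.length p : ℕ) : ZMod 2)
  map_id _ := rfl
  map_comp p q :=
    congrArg Multiplicative.ofAdd
      ((congrArg Nat.cast ((Quiver.Path.length_comp p q).trans (Nat.add_comm _ _))).trans
        (Nat.cast_add _ _))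

/-- The sign functor of the Weyl groupoid. -/
def parity : CategoryTheory.Quotient (wrel G R) ⥤ SingleObj (Multiplicative (ZMod 2)) :=
  CategoryTheory.Quotient.lift _ (pathParity G) (by
    rintro _ _ _ _ ⟨x, i, j, h⟩
    change Multiplicative.ofAdd ((Quiver.Path.length (castSrc G h _) : ℕ) : ZMod 2) =
      Multiplicative.ofAdd ((0 : ℕ) : ZMod 2)
    rw [length_castSrc, length_pathOf, length_altWord, Nat.cast_mul]
    congr 1
    simp [show (2 : ZMod 2) = 0 from rfl])

theorem length_mod_two_eq {v w : List (Fin θ)} {x x' : X}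
    (h : wordMor G R v x = wordMor G R w x') : v.length % 2 = w.length % 2 := by
  have key : ∀ m m' : Mor G R, m = m' →
      (show Multiplicative (ZMod 2) from (parity G R).map m.2.2) =
        (show Multiplicative (ZMod 2) from (parity G R).map m'.2.2) := by
    rintro m _ rfl
    rfl
  have e : Multiplicative.ofAdd ((Quiver.Path.length (pathOf G v x) : ℕ) : ZMod 2) =
      Multiplicative.ofAdd ((Quiver.Path.length (pathOf G w x') : ℕ) : ZMod 2) := key _ _ h
  rw [length_pathOf, length_pathOf] at e
  exact (ZMod.natCast_eq_natCast_iff' _ _ 2).1 (Multiplicative.ofAdd.injective e)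

theorem mnum_self (x : X) (i : Fin θ) : mnum G R x i i = 1 := by
  have hset : R.Δ x ∩ pairCone θ i i = {al θ i} := by
    ext v
    constructor
    · rintro ⟨hv, a, b, hab⟩
      rw [← add_smul] at hab
      have hmem : v ∈ ({al θ i, -al θ i} : Set (Fin θ → ℤ)) := by
        rw [← R.simple x i]
        exact ⟨hv, _, hab⟩
      rcases hmem with h | h
      · exact h
      · exfalso
        have h1 := congrFun (h.symm.trans hab) i
        simp [al] at h1
        omega
    · rintro rfl
      have hmem : al θ i ∈ R.Δ x ∩ {v | ∃ c : ℤ, v = c • al θ i} := by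
        rw [R.simple x i]
        exact Or.inl rfl
      exact ⟨hmem.1, 1, 0, by simp⟩
  rw [mnum, hset, Set.ncard_singleton]

theorem wordMor_cons_cons (i : Fin θ) (w : List (Fin θ)) (x : X) :
    wordMor G R (i :: i :: w) x = wordMor G R w x := by
  have cast_map : ∀ {a b : X} (h : a = b) (p : pob G a ⟶ pob G x),
      (CategoryTheory.Quotient.functor (wrel G R)).map (castSrc G h p) =
        castW G R h ((CategoryTheory.Quotient.functor (wrel G R)).map p) := by
    rintro a _ rfl p
    rfl
  have comp_eq : ∀ (y : X) (h : y = x) (q : homW G R y x), castW G R h q = 𝟙 (objW G R x) →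
      (⟨wsrc G w y, x, (morW G R w y ≫ q : objW G R _ ⟶ objW G R x)⟩ : Mor G R) =
        wordMor G R w x := by
    rintro y rfl q hq
    change q = _ at hq
    subst hq
    exact congrArg (fun f : homW G R (wsrc G w y) y => (⟨_, y, f⟩ : Mor G R))
      (Category.comp_id (X := objW G R _) (Y := objW G R y) (morW G R w y))
  have hrel : ∀ (n : ℕ), n = 1 → ∀ h : wsrc G (altWord i i (2 * n)) x = x,
      wrel G R (castSrc G h (pathOf G (altWord i i (2 * n)) x)) (𝟙 (pob G x)) →
      castW G R (G.invol i x) (morW G R [i, i] x) = 𝟙 (objW G R x) := by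
    rintro _ rfl h hr
    exact (cast_map h _).symm.trans (CategoryTheory.Quotient.sound _ hr)
  have hm := mnum_self G R x i
  have hsrc : wsrc G (altWord i i (2 * mnum G R x i i)) x = x := by
    rw [hm]
    exact G.invol i x
  have hone := hrel _ hm hsrc (wrel.rel x i i hsrc)
  refine Eq.trans ?_ (comp_eq _ (G.invol i x) _ hone)
  exact congrArg (fun f : homW G R (wsrc G (i :: i :: w) x) x => (⟨_, x, f⟩ : Mor G R))
    ((CategoryTheory.Quotient.functor (wrel G R)).map_comp
      (pathOf G w (G.ρ i (G.ρ i x))) (pathOf G [i, i] x))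

/-- Left multiplication by a generator changes the length. -/
theorem lenMor_cons_ne (i : Fin θ) (w : List (Fin θ)) (x : X) :
    lenMor G R (wordMor G R (i :: w) x) ≠ lenMor G R (wordMor G R w (G.ρ i x)) := by
  obtain ⟨v, hv, hvl⟩ := exists_reduced_word G R (wordMor G R (i :: w) x)
  obtain ⟨u, hu, hul⟩ := exists_reduced_word G R (wordMor G R w (G.ρ i x))
  have h1 := length_mod_two_eq G R hv
  have h2 := length_mod_two_eq G R hu
  rw [List.length_cons] at h1
  omega

theorem lenMor_cons_le (i : Fin θ) (w : List (Fin θ)) (x : X) :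
    lenMor G R (wordMor G R (i :: w) x) ≤ lenMor G R (wordMor G R w (G.ρ i x)) + 1 := by
  obtain ⟨u, hu, hul⟩ := exists_reduced_word G R (wordMor G R w (G.ρ i x))
  rw [← hul, ← wordMor_cons_congr G R hu]
  exact lenMor_wordMor_le G R (i :: u) x

theorem lenMor_tail_eq {i : Fin θ} {w : List (Fin θ)} {x : X}
    (h : (i :: w).length = lenMor G R (wordMor G R (i :: w) x)) :
    w.length = lenMor G R (wordMor G R w (G.ρ i x)) := by
  have h1 := lenMor_cons_le G R i w x
  have h2 := lenMor_wordMor_le G R w (G.ρ i x)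
  rw [List.length_cons] at h
  omega

end Words

section NilHeckeWords

variable {θ : ℕ} {X : Type} [Fintype X] [DecidableEq X] (G : SCG θ X) (R : GRS G)
  (𝕂 : Type) [CommRing 𝕂]

theorem eN_mul_eN (x y : X) :
    eN G R 𝕂 x * eN G R 𝕂 y = if x = y then eN G R 𝕂 x else 0 := by
  by_cases h : x = y
  · subst h
    rw [if_pos rfl]
    exact (map_mul _ _ _).symm.trans (RingQuot.mkAlgHom_rel 𝕂 (nrel.idem x))
  · rw [if_neg h]
    exact (map_mul _ _ _).symm.trans
      ((RingQuot.mkAlgHom_rel 𝕂 (nrel.orth x y h)).trans (map_zero _))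

theorem sum_eN : ∑ x : X, eN G R 𝕂 x = 1 :=
  (map_sum (RingQuot.mkAlgHom 𝕂 (nrel G R 𝕂)) _ _).symm.trans
    ((RingQuot.mkAlgHom_rel 𝕂 nrel.total).trans (map_one _))

theorem nN_mul_eN (x : X) (i : Fin θ) :
    nN G R 𝕂 x i * eN G R 𝕂 (G.ρ i x) = nN G R 𝕂 x i :=
  (map_mul _ _ _).symm.trans (RingQuot.mkAlgHom_rel 𝕂 (nrel.unit_right x i))

theorem eN_mul_nN (x : X) (i : Fin θ) :
    eN G R 𝕂 x * nN G R 𝕂 x i = nN G R 𝕂 x i :=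
  (map_mul _ _ _).symm.trans (RingQuot.mkAlgHom_rel 𝕂 (nrel.unit_left x i))

theorem nN_mul_nN (x : X) (i : Fin θ) : nN G R 𝕂 x i * nN G R 𝕂 (G.ρ i x) i = 0 := by
  have h : nN G R 𝕂 (G.ρ i (G.ρ i x)) i * nN G R 𝕂 (G.ρ i x) i = 0 :=
    (map_mul _ _ _).symm.trans
      ((RingQuot.mkAlgHom_rel 𝕂 (nrel.nil (G.ρ i x) i)).trans (map_zero _))
  rwa [G.invol] at h

/-- The word `n_{i_1}^x ⋯ n_{i_m}`, multiplied on the right by the idempotent of its source;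
the empty word gives `e^x`. -/
def nWe : List (Fin θ) → X → NH G R 𝕂
  | [], x => eN G R 𝕂 x
  | i :: w, x => nN G R 𝕂 x i * nWe w (G.ρ i x)

theorem nW_cons (i : Fin θ) (w : List (Fin θ)) (x : X) :
    nW G R 𝕂 (i :: w) x = nN G R 𝕂 x i * nW G R 𝕂 w (G.ρ i x) :=
  map_mul (RingQuot.mkAlgHom 𝕂 (nrel G R 𝕂)) _ _

theorem nWe_cons_eq_nW (i : Fin θ) (w : List (Fin θ)) (x : X) :
    nWe G R 𝕂 (i :: w) x = nW G R 𝕂 (i :: w) x := by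
  induction w generalizing i x with
  | nil =>
    rw [nW_cons, show nW G R 𝕂 [] (G.ρ i x) = 1 from map_one _, mul_one]
    exact nN_mul_eN G R 𝕂 x i
  | cons j w ih => rw [nW_cons, ← ih]; rfl

theorem eN_mul_nWe (x y : X) (w : List (Fin θ)) :
    eN G R 𝕂 x * nWe G R 𝕂 w y = if x = y then nWe G R 𝕂 w y else 0 := by
  cases w with
  | nil =>
    rw [nWe, eN_mul_eN]
    split_ifs with h
    · rw [h]
    · rfl
  | cons i w =>
    rw [nWe, ← eN_mul_nN, mul_assoc, ← mul_assoc, eN_mul_eN]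
    split_ifs with h
    · rw [h]
    · rw [zero_mul]

theorem nN_mul_nWe_of_ne {x y : X} {i : Fin θ} (h : G.ρ i x ≠ y) (w : List (Fin θ)) :
    nN G R 𝕂 x i * nWe G R 𝕂 w y = 0 := by
  rw [← nN_mul_eN, mul_assoc, eN_mul_nWe, if_neg h, mul_zero]

theorem Emap_single (x : X) (m : Mor G R) :
    Emap G R 𝕂 x (Finsupp.single m 1) = if m.2.1 = x then Finsupp.single m 1 else 0 := by
  simp [Emap]

theorem Lmap_single (x : X) (i : Fin θ) (m : Mor G R) :
    Lmap G R 𝕂 x i (Finsupp.single m 1) = Lval G R 𝕂 x i m := by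
  simp [Lmap]

theorem Lval_wordMor {x : X} {i : Fin θ} {w : List (Fin θ)}
    (h : lenMor G R (wordMor G R w (G.ρ i x)) < lenMor G R (wordMor G R (i :: w) x)) :
    Lval G R 𝕂 x i (wordMor G R w (G.ρ i x)) =
      Finsupp.single (wordMor G R (i :: w) x) 1 := by
  rw [← genMul_wordMor] at h ⊢
  exact (dif_pos rfl).trans (if_pos h)

/-- A submodule containing all `nWe`-words of reduced expressions is everything. -/
theorem eq_top_of_reduced_nWe_mem (S : Submodule 𝕂 (NH G R 𝕂)) (t : Mor G R → NH G R 𝕂)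
    (hS : S = Submodule.span 𝕂 (Set.range t))
    (ht : ∀ (w : List (Fin θ)) (x : X), w.length = lenMor G R (wordMor G R w x) →
      t (wordMor G R w x) = nWe G R 𝕂 w x) : S = ⊤ := by
  have hmem : ∀ m, t m ∈ S := fun m => hS ▸ Submodule.subset_span ⟨m, rfl⟩
  have hext : ∀ a : NH G R 𝕂, (∀ m, a * t m ∈ S) → ∀ b ∈ S, a * b ∈ S := by
    intro a ha b hb
    rw [hS] at hb
    induction hb using Submodule.span_induction with
    | mem b hb => obtain ⟨m, rfl⟩ := hb; exact ha m
    | zero => rw [mul_zero]; exact S.zero_mem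
    | add b c _ _ hb hc => rw [mul_add]; exact S.add_mem hb hc
    | smul r b _ hb => rw [mul_smul_comm]; exact S.smul_mem r hb
  have he : ∀ (x : X), ∀ b ∈ S, eN G R 𝕂 x * b ∈ S := by
    refine fun x => hext _ fun m => ?_
    obtain ⟨w, hw, hl⟩ := exists_reduced_word G R m
    have h := ht w m.2.1 (by rw [hw, hl])
    rw [hw] at h
    rw [h, eN_mul_nWe, ← h]
    split_ifs
    exacts [hmem m, S.zero_mem]
  have hn : ∀ (x : X) (i : Fin θ), ∀ b ∈ S, nN G R 𝕂 x i * b ∈ S := by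
    refine fun x i => hext _ fun m => ?_
    obtain ⟨w, hw, hl⟩ := exists_reduced_word G R m
    generalize m.2.1 = y at hw
    subst hw
    rw [ht w y hl]
    by_cases hy : G.ρ i x = y
    swap
    · rw [nN_mul_nWe_of_ne G R 𝕂 hy]
      exact S.zero_mem
    subst hy
    have hle := lenMor_cons_le G R i w x
    rcases lt_or_gt_of_ne (lenMor_cons_ne G R i w x) with hlt | hgt
    · obtain ⟨v, hv, hvl⟩ := exists_reduced_word G R (wordMor G R (i :: w) x)
      change wordMor G R v x = _ at hv
      have hiv : wordMor G R (i :: v) (G.ρ i x) = wordMor G R w (G.ρ i x) := by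
        rw [← wordMor_cons_cons G R i w (G.ρ i x)]
        apply wordMor_cons_congr
        rw [G.invol]
        exact hv
      have hvlen := lenMor_wordMor_le G R (i :: v) (G.ρ i x)
      rw [hiv, List.length_cons] at hvlen
      rw [← ht w _ hl, ← hiv, ht (i :: v) _ (by rw [hiv, List.length_cons]; omega), nWe,
        ← mul_assoc, nN_mul_nN, zero_mul]
      exact S.zero_mem
    · have h := ht (i :: w) x (by rw [List.length_cons]; omega)
      rw [nWe] at h
      rw [← h]
      exact hmem _
  have hall : ∀ a : FreeAlgebra 𝕂 (X ⊕ X × Fin θ), ∀ b ∈ S,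
      (show NH G R 𝕂 from RingQuot.mkAlgHom 𝕂 (nrel G R 𝕂) a) * b ∈ S := by
    intro a
    induction a using FreeAlgebra.induction with
    | grade0 r =>
      intro b hb
      have h : (show NH G R 𝕂 from RingQuot.mkAlgHom 𝕂 (nrel G R 𝕂) (algebraMap _ _ r)) =
        algebraMap 𝕂 (NH G R 𝕂) r :=
        (RingQuot.mkAlgHom 𝕂 (nrel G R 𝕂)).commutes r
      rw [h, ← Algebra.smul_def]
      exact S.smul_mem r hb
    | grade1 z =>
      rcases z with x | ⟨x, i⟩
      exacts [he x, hn x i]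
    | mul a c ha hc =>
      intro b hb
      rw [map_mul]
      exact (mul_assoc (G := NH G R 𝕂) _ _ b).symm ▸ ha _ (hc b hb)
    | add a c ha hc =>
      intro b hb
      rw [map_add]
      exact (add_mul (R := NH G R 𝕂) _ _ b).symm ▸ S.add_mem (ha b hb) (hc b hb)
  have hone : (1 : NH G R 𝕂) ∈ S := by
    rw [← sum_eN]
    refine S.sum_mem fun x _ => ?_
    have h := ht [] x (Nat.le_zero.1 (lenMor_wordMor_le G R [] x)).symm
    rw [nWe] at h
    exact h ▸ hmem _
  refine eq_top_iff.2 fun a _ => ?_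
  obtain ⟨a, rfl⟩ := RingQuot.mkAlgHom_surjective 𝕂 (nrel G R 𝕂) a
  have h := hall a 1 hone
  rwa [mul_one] at h

end NilHeckeWords

/-- **`Φ(n) := Λ(n)(1)` is a `𝕂`-module isomorphism `𝒩 ≅ 𝕂𝒲` sending `T_w` to `w`.**
Here `Λ : 𝒩 → End_𝕂(𝕂𝒲)` is the algebra homomorphism with `Λ(e^x) = E^x`,
`Λ(n_i^x) = L_i^x`, and `1 = Σ_{x∈X} id_x ∈ 𝕂𝒲`. -/
theorem Phi_module_iso {θ : ℕ} {X : Type} [Fintype X] [DecidableEq X]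
    (G : SCG θ X) (R : GRS G) (𝕂 : Type) [CommRing 𝕂]
    (Λ : NH G R 𝕂 →ₐ[𝕂] Module.End 𝕂 (KW G R 𝕂))
    (hΛe : ∀ x : X, Λ (eN G R 𝕂 x) = Emap G R 𝕂 x)
    (hΛn : ∀ (x : X) (i : Fin θ), Λ (nN G R 𝕂 x i) = Lmap G R 𝕂 x i)
    (T : ∀ y x : X, homW G R y x → NH G R 𝕂)
    (hT : ∀ (y x : X) (f : homW G R y x) (w : List (Fin θ)) (h : wsrc G w x = y),
      castW G R h (morW G R w x) = f → w.length = len G R f → 0 < w.length →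
      T y x f = nW G R 𝕂 w x)
    (hTid : ∀ x : X, T x x (𝟙 (objW G R x)) = eN G R 𝕂 x)
    (one : KW G R 𝕂)
    (hone : one = ∑ x : X, Finsupp.single (⟨x, x, 𝟙 (objW G R x)⟩ : Mor G R) (1 : 𝕂)) :
    ∃ Φ : NH G R 𝕂 ≃ₗ[𝕂] KW G R 𝕂,
      (∀ n : NH G R 𝕂, Φ n = Λ n one) ∧
      (∀ m : Mor G R, Φ (T m.1 m.2.1 m.2.2) = Finsupp.single m 1) := by
  let t : Mor G R → NH G R 𝕂 := fun m => T m.1 m.2.1 m.2.2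
  have ht : ∀ (w : List (Fin θ)) (x : X), w.length = lenMor G R (wordMor G R w x) →
      t (wordMor G R w x) = nWe G R 𝕂 w x := by
    intro w x hl
    cases w with
    | nil => exact hTid x
    | cons i w =>
      rw [nWe_cons_eq_nW]
      exact hT _ _ _ (i :: w) rfl rfl hl (Nat.succ_pos _)
  have hword : ∀ (w : List (Fin θ)) (x : X), w.length = lenMor G R (wordMor G R w x) →
      Λ (nWe G R 𝕂 w x) one = Finsupp.single (wordMor G R w x) 1 := by
    intro w
    induction w with
    | nil =>
      intro x _
      have hone' : one = ∑ y : X, Finsupp.single (wordMor G R [] y) (1 : 𝕂) := hone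
      rw [nWe, hΛe, hone', map_sum, Finset.sum_eq_single x]
      · exact (Emap_single G R 𝕂 x _).trans (if_pos rfl)
      · exact fun y _ hy => (Emap_single G R 𝕂 x _).trans (if_neg hy)
      · exact fun h => absurd (Finset.mem_univ x) h
    | cons i w ih =>
      intro x hl
      have hl' := lenMor_tail_eq G R hl
      rw [nWe, map_mul, Module.End.mul_apply, ih _ hl', hΛn, Lmap_single]
      apply Lval_wordMor
      rw [← hl, ← hl', List.length_cons]
      exact Nat.lt_succ_self _
  have hΦt : ∀ m : Mor G R, Λ (t m) one = Finsupp.single m 1 := by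
    intro m
    obtain ⟨w, hw, hl⟩ := exists_reduced_word G R m
    rw [← hw] at hl ⊢
    rw [ht _ _ hl, hword _ _ hl]
  let Φ : NH G R 𝕂 →ₗ[𝕂] KW G R 𝕂 := (LinearMap.applyₗ one).comp Λ.toLinearMap
  let Ψ : KW G R 𝕂 →ₗ[𝕂] NH G R 𝕂 := Finsupp.linearCombination 𝕂 t
  have hΦΨ : Φ.comp Ψ = LinearMap.id := by
    ext1 m
    ext1
    simpa [Φ, Ψ] using hΦt m
  have hsurj : Function.Surjective Ψ := by
    rw [← LinearMap.range_eq_top]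
    exact eq_top_of_reduced_nWe_mem G R 𝕂 _ t (Finsupp.range_linearCombination 𝕂) ht
  have hΨΦ : Ψ.comp Φ = LinearMap.id := by
    ext a
    obtain ⟨b, rfl⟩ := hsurj a
    exact congrArg Ψ (LinearMap.congr_fun hΦΨ b)
  exact ⟨LinearEquiv.ofLinearMap Φ Ψ hΦΨ hΨΦ, fun _ => rfl, hΦt⟩

end WeylGroupoid
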